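/- Let F be a finite field and let R^(1), R^(2), R^(3), R^(4), Q^(4) be 3×3 matrices over F satisfying the pair of modified direct-sum tetrahedron equations R^(1)_{123} R^(2)_{145} R^(3)_{246} R^(4)_{356} = Q^(4)_{356} R^(3)_{246} R^(2)_{145} R^(1)_{123} and R^(1)_{123} R^(2)_{145} R^(3)_{246} Q^(4)_{356} = R^(4)_{356} R^(3)_{246} R^(2)_{145} R^(1)_{123}. Then, setting 𝒯_{356} := 𝒬(R^(4)_{356}) + 𝒬(Q^(4)_{356}), the quantum tetrahedron relation ℛ^(1)_{123} ℛ^(2)_{145} ℛ^(3)_{246} 𝒯_{356} = 𝒯_{356} ℛ^(3)_{246} ℛ^(2)_{145} ℛ^(1)_{123} holds. -/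

import Mathlib

open Matrix

/-- For a 3×3 matrix `R` over `F` and distinct indices `i j k : Fin 6`, the 6×6 matrix
which equals `R` on the rows and columns `i, j, k` and the identity elsewhere. -/
def embed {F : Type*} [Zero F] [One F] (R : Matrix (Fin 3) (Fin 3) F)
    (i j k : Fin 6) : Matrix (Fin 6) (Fin 6) F := fun a b =>
  if a = i then (if b = i then R 0 0 else if b = j then R 0 1 else if b = k then R 0 2 else 0)
  else if a = j then (if b = i then R 1 0 else if b = j then R 1 1 else if b = k then R 1 2 else 0)
  else if a = k then (if b = i then R 2 0 else if b = j then R 2 1 else if b = k then R 2 2 else 0)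
  else if a = b then 1 else 0

/-- The quantization of a 6×6 matrix `M` over a finite field `F`. -/
def quant {F : Type*} [Field F] [Fintype F] [DecidableEq F]
    (M : Matrix (Fin 6) (Fin 6) F) : Matrix (Fin 6 → F) (Fin 6 → F) ℂ :=
  fun x y => if Matrix.vecMul x M = y then 1 else 0
theorem quant_mul_quant {F : Type*} [Field F] [Fintype F] [DecidableEq F]
    (M N : Matrix (Fin 6) (Fin 6) F) : quant M * quant N = quant (M * N) := by
  ext x z
  simp only [quant, Matrix.mul_apply, ← Matrix.vecMul_vecMul, ite_mul, one_mul, zero_mul]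
  rw [Finset.sum_ite_eq]
  simp

/-- If `(R⁽⁴⁾, Q⁽⁴⁾)` satisfies the pair of modified direct-sum tetrahedron equations with
`R⁽¹⁾, R⁽²⁾, R⁽³⁾`, then `𝒯 = ℛ⁽⁴⁾ + 𝒬⁽⁴⁾` satisfies the quantum tetrahedron relation. -/
theorem quantum_tetrahedron_of_modified_pair
    {F : Type*} [Field F] [Fintype F] [DecidableEq F]
    (R1 R2 R3 R4 Q4 : Matrix (Fin 3) (Fin 3) F)
    (h1 : embed R1 0 1 2 * embed R2 0 3 4 * embed R3 1 3 5 * embed R4 2 4 5 =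
          embed Q4 2 4 5 * embed R3 1 3 5 * embed R2 0 3 4 * embed R1 0 1 2)
    (h2 : embed R1 0 1 2 * embed R2 0 3 4 * embed R3 1 3 5 * embed Q4 2 4 5 =
          embed R4 2 4 5 * embed R3 1 3 5 * embed R2 0 3 4 * embed R1 0 1 2) :
    quant (embed R1 0 1 2) * quant (embed R2 0 3 4) * quant (embed R3 1 3 5) *
        (quant (embed R4 2 4 5) + quant (embed Q4 2 4 5)) =
      (quant (embed R4 2 4 5) + quant (embed Q4 2 4 5)) *
        quant (embed R3 1 3 5) * quant (embed R2 0 3 4) * quant (embed R1 0 1 2) := by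
  rw [mul_add, add_mul, add_mul, add_mul]
  simp only [quant_mul_quant]
  rw [h1, h2, add_comm]
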